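/- arXiv:0808.1359 — 2 statements merged into one kernel-verified Lean document; each statement's English description precedes it below -/
import Mathlib

section
/- Let X be a Banach space of analytic functions on the unit disk with H_∞ ↪ X ↪ H_2, and let E be any Banach sequence lattice. Then M(X̂, E) = M(ℓ_2, E), i.e., the multipliers from the Taylor coefficient space of X into E coincide with the multipliers from ℓ_2 into E. -/
open MeasureTheory Complex Filter Topology Set
open scoped ENNReal

noncomputable section

/-- The `n`-th Taylor coefficient of `f` at `0`. -/
def taylorCoeff (f : ℂ → ℂ) (n : ℕ) : ℂ := iteratedDeriv n f 0 / n.factorial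

/-- The `p`-integral mean of `f` on the circle of radius `r` (finite `p`). -/
def circleMean (p : ℝ) (f : ℂ → ℂ) (r : ℝ) : ℝ :=
  ((1 / (2 * Real.pi)) * ∫ t in (0:ℝ)..(2 * Real.pi),
      ‖f ((r : ℂ) * Complex.exp (t * Complex.I))‖ ^ p) ^ (1 / p)

/-- The sup of `|f|` on the circle of radius `r`. -/
def circleSup (f : ℂ → ℂ) (r : ℝ) : ℝ :=
  ⨆ t : ℝ, ‖f ((r : ℂ) * Complex.exp (t * Complex.I))‖

def hardyMean (p : ℝ≥0∞) (f : ℂ → ℂ) (r : ℝ) : ℝ :=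
  if p = ⊤ then circleSup f r else circleMean p.toReal f r

/-- Membership in the Hardy space `H_p` of the unit disk. -/
def MemHardy (p : ℝ≥0∞) (f : ℂ → ℂ) : Prop :=
  AnalyticOn ℂ f (Metric.ball (0:ℂ) 1) ∧
    BddAbove ((fun r => hardyMean p f r) '' Set.Ico (0:ℝ) 1)

/-- The `H_p` norm: the sup of the `p`-means over radii `0 ≤ r < 1`. -/
def hardyNorm (p : ℝ≥0∞) (f : ℂ → ℂ) : ℝ :=
  sSup ((fun r => hardyMean p f r) '' Set.Ico (0:ℝ) 1)

/-- The `ℓ_q` norm of a sequence. -/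
def lqNorm (q : ℝ≥0∞) (x : ℕ → ℂ) : ℝ :=
  if q = ⊤ then ⨆ n, ‖x n‖ else (∑' n, ‖x n‖ ^ q.toReal) ^ (1 / q.toReal)

/-- Coordinatewise multiplication of sequences. -/
def seqMul (l x : ℕ → ℂ) : ℕ → ℂ := fun n => l n * x n

/-- A Banach sequence lattice on ℤ₊: a Banach ideal space of sequences with monotone norm. -/
structure SeqLattice where
  Mem : (ℕ → ℂ) → Prop
  norm : (ℕ → ℂ) → ℝ
  zero_mem : Mem 0
  add_mem : ∀ x y, Mem x → Mem y → Mem (x + y)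
  smul_mem : ∀ (c : ℂ) x, Mem x → Mem (c • x)
  norm_nonneg : ∀ x, 0 ≤ norm x
  norm_eq_zero_iff : ∀ x, Mem x → (norm x = 0 ↔ x = 0)
  norm_add_le : ∀ x y, Mem x → Mem y → norm (x + y) ≤ norm x + norm y
  norm_smul : ∀ (c : ℂ) x, Mem x → norm (c • x) = ‖c‖ * norm x
  ideal : ∀ x y, Mem x → (∀ n, ‖y n‖ ≤ ‖x n‖) → Mem y ∧ norm y ≤ norm x
  complete : ∀ u : ℕ → (ℕ → ℂ), (∀ m, Mem (u m)) →
    (∀ ε : ℝ, 0 < ε → ∃ N, ∀ m ≥ N, ∀ n ≥ N, norm (u m - u n) ≤ ε) →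
    ∃ x, Mem x ∧ Tendsto (fun m => norm (u m - x)) atTop (𝓝 0)

/-- Order continuity: every nonnegative, pointwise nonincreasing sequence of elements of `E`
converging pointwise to `0` converges to `0` in the norm of `E`. -/
def OrderContinuous (E : SeqLattice) : Prop :=
  ∀ u : ℕ → ℕ → ℝ,
    (∀ m, E.Mem fun k => (u m k : ℂ)) →
    (∀ m k, 0 ≤ u m k) →
    (∀ k, Antitone fun m => u m k) →
    (∀ k, Tendsto (fun m => u m k) atTop (𝓝 0)) →
    Tendsto (fun m => E.norm fun k => (u m k : ℂ)) atTop (𝓝 0)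

/-- A set of sequences is solid if it is an ideal. -/
def IsSolid (S : Set (ℕ → ℂ)) : Prop :=
  ∀ x ∈ S, ∀ y : ℕ → ℂ, (∀ n, ‖y n‖ ≤ ‖x n‖) → y ∈ S

/-- The solid hull: the smallest solid set containing `A`. -/
def solidHull (A : Set (ℕ → ℂ)) : Set (ℕ → ℂ) := ⋂₀ {S | IsSolid S ∧ A ⊆ S}

/-- The set of multipliers from `F` into `E`. -/
def MultSet (F E : Set (ℕ → ℂ)) : Set (ℕ → ℂ) := {l | ∀ x ∈ F, seqMul l x ∈ E}

/-- A Banach space of analytic functions on the unit disk. -/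
structure AnalBanach where
  Mem : (ℂ → ℂ) → Prop
  norm : (ℂ → ℂ) → ℝ
  analytic : ∀ f, Mem f → AnalyticOn ℂ f (Metric.ball (0:ℂ) 1)
  zero_mem : Mem 0
  add_mem : ∀ f g, Mem f → Mem g → Mem (f + g)
  smul_mem : ∀ (c : ℂ) f, Mem f → Mem (c • f)
  norm_nonneg : ∀ f, 0 ≤ norm f
  norm_eq_zero_iff : ∀ f, Mem f → (norm f = 0 ↔ ∀ z ∈ Metric.ball (0:ℂ) 1, f z = 0)
  norm_add_le : ∀ f g, Mem f → Mem g → norm (f + g) ≤ norm f + norm g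
  norm_smul : ∀ (c : ℂ) f, Mem f → norm (c • f) = ‖c‖ * norm f
  complete : ∀ u : ℕ → (ℂ → ℂ), (∀ m, Mem (u m)) →
    (∀ ε : ℝ, 0 < ε → ∃ N, ∀ m ≥ N, ∀ n ≥ N, norm (u m - u n) ≤ ε) →
    ∃ f, Mem f ∧ Tendsto (fun m => norm (u m - f)) atTop (𝓝 0)

/-- The Taylor coefficient space `X̂` of a space of analytic functions. -/
def coeffSpace (X : AnalBanach) : Set (ℕ → ℂ) := {a | ∃ f, X.Mem f ∧ a = taylorCoeff f}

/-- `H_p ↪ X` continuously. -/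
def EmbedHardyIn (p : ℝ≥0∞) (X : AnalBanach) : Prop :=
  ∃ C : ℝ, 0 < C ∧ ∀ f, MemHardy p f → X.Mem f ∧ X.norm f ≤ C * hardyNorm p f

/-- `X ↪ H_p` continuously. -/
def EmbedInHardy (X : AnalBanach) (p : ℝ≥0∞) : Prop :=
  ∃ C : ℝ, 0 < C ∧ ∀ f, X.Mem f → MemHardy p f ∧ hardyNorm p f ≤ C * X.norm f

/-- Hausdorff measure of noncompactness of a set in a Banach sequence lattice. -/
def hmnc (E : SeqLattice) (A : Set (ℕ → ℂ)) : ℝ :=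
  sInf {ε : ℝ | 0 < ε ∧ ∃ Z : Finset (ℕ → ℂ),
    (∀ z ∈ Z, E.Mem z) ∧ ∀ x ∈ A, ∃ z ∈ Z, E.norm (x - z) ≤ ε}

/-- Hausdorff measure of noncompactness of a set of sequences in the `ℓ_q` metric. -/
def hmncLq (q : ℝ≥0∞) (A : Set (ℕ → ℂ)) : ℝ :=
  sInf {ε : ℝ | 0 < ε ∧ ∃ Z : Finset (ℕ → ℂ), ∀ x ∈ A, ∃ z ∈ Z, lqNorm q (x - z) ≤ ε}

/-- Relative compactness (total boundedness) of a set in a Banach sequence lattice. -/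
def RelCompactIn (E : SeqLattice) (A : Set (ℕ → ℂ)) : Prop :=
  ∀ ε : ℝ, 0 < ε → ∃ Z : Finset (ℕ → ℂ),
    (∀ z ∈ Z, E.Mem z) ∧ ∀ x ∈ A, ∃ z ∈ Z, E.norm (x - z) ≤ ε

/-- Relative compactness (total boundedness) of a set of sequences in `ℓ_q`. -/
def RelCompactInLq (q : ℝ≥0∞) (A : Set (ℕ → ℂ)) : Prop :=
  ∀ ε : ℝ, 0 < ε → ∃ Z : Finset (ℕ → ℂ), ∀ x ∈ A, ∃ z ∈ Z, lqNorm q (x - z) ≤ ε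

/-- The closed unit ball of `H_p`. -/
def hardyBall (p : ℝ≥0∞) : Set (ℂ → ℂ) := {f | MemHardy p f ∧ hardyNorm p f ≤ 1}

/-- The multiplier operator `M_λ : H_p → ℓ_q` is (bounded into `ℓ_q` and) compact. -/
def MulCompactHardyLq (p q : ℝ≥0∞) (l : ℕ → ℂ) : Prop :=
  (∀ f, MemHardy p f → Memℓp (seqMul l (taylorCoeff f)) q) ∧
  RelCompactInLq q ((fun f => seqMul l (taylorCoeff f)) '' hardyBall p)

/-- The multiplier operator `M_λ : X → E` maps `X` into `E` and is compact. -/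
def MulCompactX (X : AnalBanach) (E : SeqLattice) (l : ℕ → ℂ) : Prop :=
  (∀ f, X.Mem f → E.Mem (seqMul l (taylorCoeff f))) ∧
  RelCompactIn E ((fun f => seqMul l (taylorCoeff f)) '' {f | X.Mem f ∧ X.norm f ≤ 1})



open Real in
lemma coeff_avg {f : ℂ → ℂ} {r : ℝ} (hr : 0 < r) (hf : DiffContOnCl ℂ f (Metric.ball 0 r)) (n : ℕ) :
    circleAverage (fun z => f (r * z) * (starRingEnd ℂ z) ^ n) 0 1 = taylorCoeff f n * r ^ n := by
  have h0 := DiffContOnCl.circleIntegral_one_div_sub_center_pow_smul hr n hf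
  have h1 : circleAverage (fun z => f z * (r / z) ^ n) 0 r = taylorCoeff f n * r ^ n := by
    rw [circleAverage_eq_circleIntegral hr.ne']
    have : (∮ z in C(0, r), (z - 0)⁻¹ • (f z * ((r:ℂ) / z) ^ n))
        = (r:ℂ) ^ n * ∮ z in C(0, r), (1 / (z - 0) ^ (n + 1)) • f z := by
      rw [← circleIntegral.integral_const_mul]
      congr 1; ext z
      simp only [sub_zero, smul_eq_mul, div_pow, pow_succ, one_div, mul_inv]
      ring
    rw [this, h0, taylorCoeff]
    have hpi : (2 * π * I : ℂ) ≠ 0 := by simp [Real.pi_ne_zero]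
    have := Nat.factorial_ne_zero n
    simp only [smul_eq_mul]
    field_simp
  rw [← h1, circleAverage_eq_circleAverage_zero_one (c := 0) (R := r)]
  apply circleAverage_congr_sphere
  intro z hz
  have hz1 : ‖z‖ = 1 := by simpa using hz
  have hz0 : z ≠ 0 := by intro h; simp [h] at hz1
  have hc : starRingEnd ℂ z = z⁻¹ := by
    rw [Complex.inv_def, Complex.normSq_eq_norm_sq, hz1]; simp
  have hr0 : (r:ℂ) ≠ 0 := by exact_mod_cast hr.ne'
  simp only [hc, add_zero]
  congr 2
  field_simp

/-- polynomial with coefficients `c`. -/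
def poly (N : ℕ) (c : ℕ → ℂ) (z : ℂ) : ℂ := ∑ n ∈ Finset.range N, c n * z ^ n

lemma poly_diff (N : ℕ) (c : ℕ → ℂ) : Differentiable ℂ (poly N c) := by
  unfold poly; fun_prop

lemma poly_cont (N : ℕ) (c : ℕ → ℂ) : Continuous (poly N c) := (poly_diff N c).continuous

lemma exists_h (N : ℕ) (c : ℕ → ℂ) : ∃ h : ℂ → ℂ, Differentiable ℂ h ∧
    (∀ z, ‖z‖ = 1 → (h z).re = ‖poly N c z‖ ^ 2) ∧
    h 0 = ((∑ n ∈ Finset.range N, ‖c n‖ ^ 2 : ℝ) : ℂ) := by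
  induction N with
  | zero => exact ⟨fun _ => 0, differentiable_const (0:ℂ), by simp [poly], by simp⟩
  | succ N ih =>
    obtain ⟨h, hd, hre, h0⟩ := ih
    refine ⟨fun z => h z + ((‖c N‖ ^ 2 : ℝ) : ℂ) +
      2 * c N * ∑ k ∈ Finset.range N, starRingEnd ℂ (c k) * z ^ (N - k), by fun_prop, ?_, ?_⟩
    · intro z hz
      have hz0 : z ≠ 0 := by intro h; simp [h] at hz
      have hc : starRingEnd ℂ z = z⁻¹ := by
        rw [Complex.inv_def, Complex.normSq_eq_norm_sq, hz]; simp
      have e1 : ∑ k ∈ Finset.range N, starRingEnd ℂ (c k) * z ^ (N - k)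
          = z ^ N * starRingEnd ℂ (poly N c z) := by
        rw [poly, map_sum, Finset.mul_sum]
        refine Finset.sum_congr rfl fun k hk => ?_
        have hk : k ≤ N := (Finset.mem_range.1 hk).le
        rw [map_mul, map_pow, hc, pow_sub₀ _ hz0 hk, inv_pow]
        ring
      have e2 : poly (N+1) c z = poly N c z + c N * z ^ N := by
        simp [poly, Finset.sum_range_succ]
      have e3 : ‖c N * z ^ N‖ = ‖c N‖ := by simp [hz]
      beta_reduce
      rw [e2, e1, ← Complex.normSq_eq_norm_sq (poly N c z + _), Complex.normSq_add,
        Complex.normSq_eq_norm_sq, Complex.normSq_eq_norm_sq, e3, ← hre z hz]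
      have : (poly N c z * starRingEnd ℂ (c N * z ^ N)).re
        = (c N * (z ^ N * starRingEnd ℂ (poly N c z))).re := by
        rw [← Complex.conj_re]; congr 1; simp; ring
      rw [this]
      have e4 : 2 * c N * (z ^ N * starRingEnd ℂ (poly N c z)) =
        ((2:ℝ):ℂ) * (c N * (z ^ N * starRingEnd ℂ (poly N c z))) := by push_cast; ring
      rw [e4, Complex.add_re, Complex.add_re, Complex.re_ofReal_mul, Complex.ofReal_re]
    · simp only [h0, Finset.sum_range_succ]
      rw [Finset.sum_eq_zero (s := Finset.range N) (f := fun k => starRingEnd ℂ (c k) * 0 ^ (N - k))]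
      · push_cast; ring
      · intro k hk
        have := Finset.mem_range.1 hk
        rw [zero_pow (by omega), mul_zero]

lemma ci {F : Type*} [NormedAddCommGroup F] {u : ℂ → F} (hu : ContinuousOn u (Metric.sphere 0 1)) :
    CircleIntegrable u 0 1 := hu.circleIntegrable (by norm_num)

open Real in
lemma avg_re {u : ℂ → ℂ} (hu : ContinuousOn u (Metric.sphere 0 1)) :
    circleAverage (fun z => (u z).re) 0 1 = (circleAverage u 0 1).re :=
  Complex.reCLM.circleAverage_comp_comm (ci hu)

open Real in
lemma avg_entire {h : ℂ → ℂ} (hd : Differentiable ℂ h) :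
    circleAverage (fun z => (h z).re) 0 1 = (h 0).re := by
  rw [avg_re hd.continuous.continuousOn, DiffContOnCl.circleAverage hd.diffContOnCl]

open Real in
lemma parseval (N : ℕ) (c : ℕ → ℂ) :
    circleAverage (fun z => ‖poly N c z‖ ^ 2) 0 1 = ∑ n ∈ Finset.range N, ‖c n‖ ^ 2 := by
  obtain ⟨h, hd, hre, h0⟩ := exists_h N c
  rw [← circleAverage_congr_sphere (f₁ := fun z => (h z).re), avg_entire hd, h0, Complex.ofReal_re]
  intro z hz
  exact hre z (by simpa using hz)

lemma four_pt (A w : ℂ) : ‖A + w‖ ^ 4 + ‖A - w‖ ^ 4 ≤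
    2 * (‖A‖ ^ 4 + 6 * ‖A‖ ^ 2 * ‖w‖ ^ 2 + ‖w‖ ^ 4) := by
  have h1 : ‖A + w‖ ^ 2 = ‖A‖ ^ 2 + ‖w‖ ^ 2 + 2 * (A * starRingEnd ℂ w).re := by
    simpa [Complex.normSq_eq_norm_sq] using Complex.normSq_add A w
  have h2 : ‖A - w‖ ^ 2 = ‖A‖ ^ 2 + ‖w‖ ^ 2 - 2 * (A * starRingEnd ℂ w).re := by
    simpa [Complex.normSq_eq_norm_sq] using Complex.normSq_sub A w
  have h3 : |(A * starRingEnd ℂ w).re| ≤ ‖A‖ * ‖w‖ := by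
    simpa using Complex.abs_re_le_norm (A * starRingEnd ℂ w)
  have h4 : (A * starRingEnd ℂ w).re ^ 2 ≤ (‖A‖ * ‖w‖) ^ 2 := sq_le_sq' (by linarith [neg_abs_le (A * starRingEnd ℂ w).re]) (le_trans (le_abs_self _) h3)
  have e1 : ‖A + w‖ ^ 4 = (‖A + w‖ ^ 2) ^ 2 := by ring
  have e2 : ‖A - w‖ ^ 4 = (‖A - w‖ ^ 2) ^ 2 := by ring
  rw [e1, e2, h1, h2]
  nlinarith

lemma poly_congr {N : ℕ} {c d : ℕ → ℂ} (h : ∀ n < N, c n = d n) : poly N c = poly N d := by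
  ext z; exact Finset.sum_congr rfl fun n hn => by rw [h n (Finset.mem_range.1 hn)]

open Real in
lemma signs (N : ℕ) (b : ℕ → ℂ) : ∃ ε : ℕ → ℂ, (∀ n, ε n = 1 ∨ ε n = -1) ∧
    circleAverage (fun z => ‖poly N (fun n => ε n * b n) z‖ ^ 4) 0 1 ≤
      3 * (∑ n ∈ Finset.range N, ‖b n‖ ^ 2) ^ 2 := by
  induction N with
  | zero => exact ⟨fun _ => 1, by simp, by simp [poly, circleAverage_const]⟩
  | succ N ih =>
    obtain ⟨ε, hε, hav⟩ := ih
    set S := ∑ n ∈ Finset.range N, ‖b n‖ ^ 2 with hS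
    set A := poly N (fun n => ε n * b n) with hA
    have hAc : Continuous A := poly_cont _ _
    have hpars : circleAverage (fun z => ‖A z‖ ^ 2) 0 1 = S := by
      rw [hA, parseval, hS]
      refine Finset.sum_congr rfl fun n _ => ?_
      rcases hε n with h | h <;> simp [h]
    have key : circleAverage (fun z => ‖A z + b N * z ^ N‖ ^ 4) 0 1 +
        circleAverage (fun z => ‖A z - b N * z ^ N‖ ^ 4) 0 1 ≤
        2 * (3 * (S + ‖b N‖ ^ 2) ^ 2) := by
      have hc1 : CircleIntegrable (fun z => ‖A z + b N * z ^ N‖ ^ 4) 0 1 :=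
        ci (Continuous.continuousOn (by fun_prop))
      have hc2 : CircleIntegrable (fun z => ‖A z - b N * z ^ N‖ ^ 4) 0 1 :=
        ci (Continuous.continuousOn (by fun_prop))
      have hc3 : CircleIntegrable (fun z => ‖A z‖ ^ 4) 0 1 :=
        ci (Continuous.continuousOn (by fun_prop))
      have hc4 : CircleIntegrable (fun z => ‖A z‖ ^ 2) 0 1 :=
        ci (Continuous.continuousOn (by fun_prop))
      have hc5 : CircleIntegrable (fun _ => 2 * ‖b N‖ ^ 4 : ℂ → ℝ) 0 1 :=
        ci (Continuous.continuousOn (by fun_prop))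
      have hc6 : CircleIntegrable (fun z => (2:ℝ) • ‖A z‖ ^ 4) 0 1 :=
        ci (Continuous.continuousOn (by fun_prop))
      have hc7 : CircleIntegrable (fun z => (12 * ‖b N‖ ^ 2) • ‖A z‖ ^ 2) 0 1 :=
        ci (Continuous.continuousOn (by fun_prop))
      have hc67 : CircleIntegrable (fun z => (2:ℝ) • ‖A z‖ ^ 4 + (12 * ‖b N‖ ^ 2) • ‖A z‖ ^ 2) 0 1 :=
        ci (Continuous.continuousOn (by fun_prop))
      rw [← circleAverage_fun_add hc1 hc2]
      calc _ ≤ circleAverage (fun z => (2:ℝ) • ‖A z‖ ^ 4 + (12 * ‖b N‖ ^ 2) • ‖A z‖ ^ 2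
              + 2 * ‖b N‖ ^ 4) 0 1 := by
            apply circleAverage_mono (ci (Continuous.continuousOn (by fun_prop)))
              (ci (Continuous.continuousOn (by fun_prop)))
            intro z hz
            have hz : ‖z‖ = 1 := by simpa using hz
            have := four_pt (A z) (b N * z ^ N)
            have e : ‖b N * z ^ N‖ = ‖b N‖ := by simp [hz]
            rw [e] at this
            simp only [smul_eq_mul]
            linarith
        _ ≤ _ := by
            rw [circleAverage_fun_add hc67 hc5, circleAverage_fun_add hc6 hc7,
              circleAverage_fun_smul, circleAverage_fun_smul, hpars, circleAverage_const]
            simp only [smul_eq_mul]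
            nlinarith [sq_nonneg (‖b N‖ ^ 2)]
    have hps : ∀ s : ℂ, poly (N+1) (fun n => Function.update ε N s n * b n)
        = fun z => A z + s * b N * z ^ N := by
      intro s; ext z
      have : poly N (fun n => Function.update ε N s n * b n) = A :=
        poly_congr fun n hn => by rw [Function.update_of_ne hn.ne]
      rw [← this]
      simp [poly, Finset.sum_range_succ]
    have hsum : ∑ n ∈ Finset.range (N+1), ‖b n‖ ^ 2 = S + ‖b N‖ ^ 2 := Finset.sum_range_succ _ _
    rw [hsum]
    by_cases hle : circleAverage (fun z => ‖A z + b N * z ^ N‖ ^ 4) 0 1 ≤ 3 * (S + ‖b N‖ ^ 2) ^ 2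
    · refine ⟨Function.update ε N 1, ?_, ?_⟩
      · intro n; by_cases h : n = N
        · subst h; simp
        · simpa [Function.update_of_ne h] using hε n
      · rw [hps]; simpa using hle
    · refine ⟨Function.update ε N (-1), ?_, ?_⟩
      · intro n; by_cases h : n = N
        · subst h; simp
        · simpa [Function.update_of_ne h] using hε n
      · rw [hps]
        have : (fun z => ‖A z + -1 * b N * z ^ N‖ ^ 4) = fun z => ‖A z - b N * z ^ N‖ ^ 4 := by
          ext z; congr 2; ring
        rw [this]
        linarith

lemma norm_sq_re (w : ℂ) : ‖w‖ ^ 2 = 2 * w.re ^ 2 - (w ^ 2).re := by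
  rw [← Complex.normSq_eq_norm_sq, Complex.normSq_apply, pow_two w, Complex.mul_re]; ring

lemma conj_poly (N : ℕ) (c : ℕ → ℂ) (z : ℂ) : starRingEnd ℂ (poly N c z) =
    ∑ n ∈ Finset.range N, starRingEnd ℂ (c n) * (starRingEnd ℂ z) ^ n := by
  simp [poly]

open Real in
lemma pairing {f : ℂ → ℂ} {r : ℝ} (hr : 0 < r) (hf : DiffContOnCl ℂ f (Metric.ball 0 r))
    (N : ℕ) (c : ℕ → ℂ) :
    circleAverage (fun z => f (r * z) * starRingEnd ℂ (poly N c z)) 0 1 =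
      ∑ n ∈ Finset.range N, starRingEnd ℂ (c n) * (taylorCoeff f n * r ^ n) := by
  have hfc : ContinuousOn (fun z => f (r * z)) (Metric.sphere 0 1) := by
    refine hf.continuousOn.comp (by fun_prop) ?_
    intro z hz
    rw [closure_ball _ hr.ne']
    have hz : ‖z‖ = 1 := by simpa using hz
    simp [hz, abs_of_pos hr]
  have e : (fun z => f (r * z) * starRingEnd ℂ (poly N c z)) =
      fun z => ∑ n ∈ Finset.range N, starRingEnd ℂ (c n) • (f (r * z) * (starRingEnd ℂ z) ^ n) := by
    ext z
    rw [conj_poly, Finset.mul_sum]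
    refine Finset.sum_congr rfl fun n _ => ?_
    simp only [smul_eq_mul]; ring
  have hcc : Continuous (starRingEnd ℂ) := Complex.continuous_conj
  rw [e, circleAverage_fun_sum]
  · refine Finset.sum_congr rfl fun n _ => ?_
    rw [circleAverage_fun_smul, coeff_avg hr hf, smul_eq_mul]
  · intro n _
    apply ci
    have := hfc.mul (hcc.pow n).continuousOn
    exact (continuousOn_const (c := starRingEnd ℂ (c n))).mul this

open Real in
lemma bessel {f : ℂ → ℂ} {r : ℝ} (hr : 0 < r) (hf : DiffContOnCl ℂ f (Metric.ball 0 r)) (N : ℕ) :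
    ∑ n ∈ Finset.range N, ‖taylorCoeff f n * r ^ n‖ ^ 2 ≤
      circleAverage (fun z => ‖f (r * z)‖ ^ 2) 0 1 := by
  set c : ℕ → ℂ := fun n => taylorCoeff f n * r ^ n with hc
  have hfc : ContinuousOn (fun z => f (r * z)) (Metric.sphere 0 1) := by
    refine hf.continuousOn.comp (by fun_prop) ?_
    intro z hz
    rw [closure_ball _ hr.ne']
    have hz : ‖z‖ = 1 := by simpa using hz
    simp [hz, abs_of_pos hr]
  have hp := poly_cont N c
  have hcc : Continuous (starRingEnd ℂ) := Complex.continuous_conj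
  have hprod : ContinuousOn (fun z => f (r * z) * starRingEnd ℂ (poly N c z)) (Metric.sphere 0 1) :=
    hfc.mul (hcc.comp hp).continuousOn
  have h1 : circleAverage (fun z => (f (r * z) * starRingEnd ℂ (poly N c z)).re) 0 1
      = ∑ n ∈ Finset.range N, ‖c n‖ ^ 2 := by
    rw [avg_re hprod, pairing hr hf, Complex.re_sum]
    refine Finset.sum_congr rfl fun n _ => ?_
    rw [Complex.conj_mul']
    norm_cast
  have h2 := parseval N c
  have hre : ContinuousOn (fun z => (f (r * z) * starRingEnd ℂ (poly N c z)).re) (Metric.sphere 0 1) :=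
    Complex.continuous_re.comp_continuousOn hprod
  have i1 : CircleIntegrable (fun z => ‖f (r * z)‖ ^ 2) 0 1 := ci (hfc.norm.pow 2)
  have i2 : CircleIntegrable (fun z => ‖poly N c z‖ ^ 2) 0 1 := ci (hp.norm.pow 2).continuousOn
  have i3 : CircleIntegrable (fun z => (2:ℝ) • (f (r * z) * starRingEnd ℂ (poly N c z)).re) 0 1 :=
    ci ((continuousOn_const (c := (2:ℝ))).mul hre)
  have i4 : CircleIntegrable (fun z => ‖f (r * z)‖ ^ 2 + ‖poly N c z‖ ^ 2) 0 1 :=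
    ci ((hfc.norm.pow 2).add (hp.norm.pow 2).continuousOn)
  have h3 : 0 ≤ circleAverage (fun z => (‖f (r * z)‖ ^ 2 + ‖poly N c z‖ ^ 2) -
      (2:ℝ) • (f (r * z) * starRingEnd ℂ (poly N c z)).re) 0 1 := by
    apply circleAverage_nonneg_of_nonneg
    intro z _
    have := Complex.normSq_sub (f (r * z)) (poly N c z)
    simp only [Complex.normSq_eq_norm_sq] at this
    simp only [smul_eq_mul]
    rw [← this]; positivity
  rw [circleAverage_fun_sub i4 i3, circleAverage_fun_add i1 i2, circleAverage_fun_smul, h1, h2,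
    smul_eq_mul] at h3
  linarith

open Real in
lemma memlp_of_hardy {f : ℂ → ℂ} (hf : MemHardy 2 f) : Memℓp (taylorCoeff f) 2 := by
  obtain ⟨han, B, hB⟩ := hf
  have hd : DifferentiableOn ℂ f (Metric.ball 0 1) := han.differentiableOn
  have hmain : ∀ r : ℝ, 0 < r → r < 1 → ∀ N,
      ∑ n ∈ Finset.range N, ‖taylorCoeff f n * r ^ n‖ ^ 2 ≤ B ^ 2 := by
    intro r hr hr1 N
    have hcl : DiffContOnCl ℂ f (Metric.ball 0 r) := by
      apply (hd.mono ?_).diffContOnCl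
      rw [closure_ball _ hr.ne']
      exact Metric.closedBall_subset_ball hr1
    refine (bessel hr hcl N).trans ?_
    have hb : hardyMean 2 f r ≤ B := hB ⟨r, ⟨hr.le, hr1⟩, rfl⟩
    have e : hardyMean 2 f r = √ (circleAverage (fun z => ‖f (r * z)‖ ^ 2) 0 1) := by
      rw [hardyMean, if_neg (by norm_num), circleMean, Real.sqrt_eq_rpow]
      simp [circleAverage, circleMap]
    rw [e] at hb
    exact (Real.sqrt_le_left (le_trans (Real.sqrt_nonneg _) hb)).1 hb
  have hlim : ∀ N, ∑ n ∈ Finset.range N, ‖taylorCoeff f n‖ ^ 2 ≤ B ^ 2 := by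
    intro N
    have ht : Tendsto (fun r : ℝ => ∑ n ∈ Finset.range N, ‖taylorCoeff f n * (r:ℂ) ^ n‖ ^ 2)
        (𝓝[<] 1) (𝓝 (∑ n ∈ Finset.range N, ‖taylorCoeff f n * ((1:ℝ):ℂ) ^ n‖ ^ 2)) := by
      apply Tendsto.mono_left _ nhdsWithin_le_nhds
      apply Continuous.tendsto
      fun_prop
    simp only [Complex.ofReal_one, one_pow, mul_one] at ht
    refine le_of_tendsto ht ?_
    have h0 : ∀ᶠ r : ℝ in 𝓝[<] 1, 0 < r :=
      nhdsWithin_le_nhds (lt_mem_nhds (by norm_num : (0:ℝ) < 1))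
    filter_upwards [h0, self_mem_nhdsWithin] with r hr hr1
    exact hmain r hr hr1 N
  rw [memℓp_gen_iff (by norm_num)]
  apply summable_of_sum_range_le (c := B ^ 2)
  · intro n; positivity
  · intro N; simpa using hlim N

open Real in
lemma key (N : ℕ) (b : ℕ → ℂ) : ∃ ε : ℕ → ℂ, (∀ n, ε n = 1 ∨ ε n = -1) ∧ ∃ f : ℂ → ℂ,
    DifferentiableOn ℂ f (Metric.ball 0 1) ∧
    (∀ z ∈ Metric.ball (0:ℂ) 1, ‖f z‖ ≤ 3 / 2 * √(∑ n ∈ Finset.range N, ‖b n‖ ^ 2)) ∧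
    (∑ n ∈ Finset.range N, ‖b n‖ ^ 2) / 2 ≤
      ‖∑ n ∈ Finset.range N, ε n * b n * taylorCoeff f n‖ := by
  obtain ⟨ε, hε, h4⟩ := signs N (fun n => starRingEnd ℂ (b n))
  simp only [RCLike.norm_conj] at h4
  refine ⟨ε, hε, ?_⟩
  set S := ∑ n ∈ Finset.range N, ‖b n‖ ^ 2 with hS
  have hS0 : 0 ≤ S := by positivity
  rcases hS0.eq_or_lt with hS0 | hSpos
  · exact ⟨fun _ => 0, differentiableOn_const _, by simp, by rw [← hS0]; simp⟩
  set c : ℕ → ℂ := fun n => ε n * starRingEnd ℂ (b n) with hc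
  have hcb : ∀ n, starRingEnd ℂ (c n) = ε n * b n := by
    intro n; rcases hε n with h | h <;> simp [hc, h]
  have hcn : ∀ n, ‖c n‖ = ‖b n‖ := by
    intro n; rcases hε n with h | h <;> simp [hc, h]
  set g := poly N c with hg
  have hgd : Differentiable ℂ g := poly_diff N c
  have hgc := hgd.continuous
  obtain ⟨h, hd, hre, h0⟩ := exists_h N c
  simp only [hcn] at h0
  rw [← hS] at h0
  set μ : ℝ := 9 * S with hμ
  have hμpos : 0 < μ := by positivity
  set H : ℂ → ℂ := fun z => ((μ⁻¹ : ℝ) : ℂ) * h z with hH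
  have hHd : Differentiable ℂ H := hd.const_mul _
  have hHc := hHd.continuous
  have hHre : ∀ z, ‖z‖ = 1 → (H z).re = ‖g z‖ ^ 2 / μ := by
    intro z hz
    rw [hH, Complex.re_ofReal_mul, hre z hz]; field_simp; rfl
  -- positivity in the disc
  have hpos : ∀ z ∈ Metric.closedBall (0:ℂ) 1, 0 ≤ (H z).re := by
    intro z hz
    have := Complex.norm_le_of_forall_mem_frontier_norm_le (f := fun z => Complex.exp (-H z))
      (U := Metric.ball (0:ℂ) 1) Metric.isBounded_ball (hHd.neg.cexp.diffContOnCl) (C := 1) ?_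
      (z := z) (by rwa [closure_ball _ one_ne_zero])
    · rw [Complex.norm_exp, Real.exp_le_one_iff, Complex.neg_re] at this
      linarith
    · intro w hw
      rw [frontier_ball _ one_ne_zero] at hw
      rw [Complex.norm_exp, Real.exp_le_one_iff, Complex.neg_re, hHre w (by simpa using hw)]
      have : 0 ≤ ‖g w‖ ^ 2 / μ := by positivity
      linarith
  have hnorm1 : ∀ z ∈ Metric.closedBall (0:ℂ) 1, 1 + (H z).re ≤ ‖1 + H z‖ := by
    intro z hz
    have := Complex.re_le_norm (1 + H z)
    simpa using this
  have hne : ∀ z ∈ Metric.closedBall (0:ℂ) 1, 1 + H z ≠ 0 := by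
    intro z hz h
    have := hnorm1 z hz
    rw [h, norm_zero] at this
    linarith [hpos z hz]
  set f : ℂ → ℂ := fun z => g z / (1 + H z) with hf
  have hfd : DifferentiableOn ℂ f (Metric.closedBall 0 1) := by
    intro z hz
    exact ((hgd z).div ((differentiableAt_const _).add (hHd z)) (hne z hz)).differentiableWithinAt
  have hfcl : DiffContOnCl ℂ f (Metric.ball 0 1) := by
    apply DifferentiableOn.diffContOnCl
    rwa [closure_ball _ one_ne_zero]
  have hsub : Metric.sphere (0:ℂ) 1 ⊆ Metric.closedBall 0 1 := Metric.sphere_subset_closedBall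
  refine ⟨f, hfd.mono Metric.ball_subset_closedBall, ?_, ?_⟩
  · intro z hz
    refine Complex.norm_le_of_forall_mem_frontier_norm_le (U := Metric.ball (0:ℂ) 1)
      Metric.isBounded_ball hfcl ?_ (subset_closure hz)
    intro w hw
    rw [frontier_ball _ one_ne_zero] at hw
    have h1 := hnorm1 w (hsub hw)
    rw [hHre w (by simpa using hw)] at h1
    rw [hf, norm_div, div_le_iff₀ (norm_pos_iff.2 (hne w (hsub hw)))]
    have hs := Real.sq_sqrt hSpos.le
    have hsp : 0 < √S := Real.sqrt_pos.2 hSpos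
    have : ‖g w‖ ≤ 3 / 2 * √S * (1 + ‖g w‖ ^ 2 / μ) := by
      rw [hμ]
      nth_rewrite 2 [← hs]
      have e : 3 / 2 * √S * (1 + ‖g w‖ ^ 2 / (9 * √S ^ 2)) - ‖g w‖ =
        (‖g w‖ - 3 * √S) ^ 2 / (6 * √S) := by field_simp; ring
      have : 0 ≤ (‖g w‖ - 3 * √S) ^ 2 / (6 * √S) := by positivity
      linarith
    refine this.trans ?_
    gcongr
  · have hpair := pairing one_pos hfcl N c
    simp only [hcb, Complex.ofReal_one, one_mul, one_pow, mul_one] at hpair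
    rw [← hpair]
    refine le_trans ?_ (Complex.re_le_norm _)
    have hcc : Continuous (starRingEnd ℂ) := Complex.continuous_conj
    have hprod : ContinuousOn (fun z => f z * starRingEnd ℂ (poly N c z)) (Metric.sphere 0 1) :=
      (hfd.continuousOn.mono hsub).mul (hcc.comp hgc).continuousOn
    rw [← avg_re hprod]
    have i1 : CircleIntegrable (fun z => ‖g z‖ ^ 2) 0 1 := ci (hgc.norm.pow 2).continuousOn
    have hre2 : Continuous (fun z => (H z ^ 2).re) := Complex.continuous_re.comp (hHc.pow 2)
    have i2 : CircleIntegrable (fun z => (3 / 2 / μ) • ‖g z‖ ^ 4) 0 1 :=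
      ci (Continuous.continuousOn (by fun_prop))
    have i3 : CircleIntegrable (fun z => (μ / 2) • (H z ^ 2).re) 0 1 :=
      ci (Continuous.continuousOn (by fun_prop))
    have i12 : CircleIntegrable (fun z => ‖g z‖ ^ 2 - (3 / 2 / μ) • ‖g z‖ ^ 4) 0 1 :=
      ci (Continuous.continuousOn (by fun_prop))
    have i123 : CircleIntegrable (fun z => (‖g z‖ ^ 2 - (3 / 2 / μ) • ‖g z‖ ^ 4)
        + (μ / 2) • (H z ^ 2).re) 0 1 :=
      ci (Continuous.continuousOn (by fun_prop))
    have low : circleAverage (fun z => (‖g z‖ ^ 2 - (3 / 2 / μ) • ‖g z‖ ^ 4)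
        + (μ / 2) • (H z ^ 2).re) 0 1 ≤
        circleAverage (fun z => (f z * starRingEnd ℂ (poly N c z)).re) 0 1 := by
      apply circleAverage_mono i123 (ci (Complex.continuous_re.comp_continuousOn hprod))
      intro z hz
      have hz : z ∈ Metric.sphere (0:ℂ) 1 := by simpa using hz
      have hzn : ‖z‖ = 1 := by simpa using hz
      have hzc := hsub hz
      have hr := hHre z hzn
      have hn := hne z hzc
      have h1 : 1 ≤ ‖1 + H z‖ := by linarith [hnorm1 z hzc, hpos z hzc]
      have e1 : f z * starRingEnd ℂ (poly N c z) =
          ((‖g z‖ ^ 2 : ℝ) : ℂ) * (1 - H z / (1 + H z)) := by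
        have : g z * starRingEnd ℂ (g z) = ((‖g z‖ ^ 2 : ℝ) : ℂ) := by
          rw [Complex.mul_conj']; norm_cast
        rw [← this, hf, ← hg]
        field_simp
        ring
      have e2 : (H z / (1 + H z)).re ≤ ‖H z‖ := by
        refine (Complex.re_le_norm _).trans ?_
        rw [norm_div]
        exact div_le_self (norm_nonneg _) h1
      have e3 : ‖H z‖ ^ 2 = 2 * (H z).re ^ 2 - (H z ^ 2).re := norm_sq_re (H z)
      change _ ≤ (f z * starRingEnd ℂ (poly N c z)).re
      rw [e1, Complex.re_ofReal_mul, Complex.sub_re, Complex.one_re]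
      simp only [smul_eq_mul]
      have e4 : (H z ^ 2).re = 2 * (‖g z‖ ^ 2 / μ) ^ 2 - ‖H z‖ ^ 2 := by rw [e3, hr]; ring
      rw [e4]
      have e5 : ‖g z‖ ^ 2 * (1 - ‖H z‖) ≤ ‖g z‖ ^ 2 * (1 - (H z / (1 + H z)).re) := by gcongr
      refine le_trans ?_ e5
      have e6 : ‖g z‖ ^ 2 * (1 - ‖H z‖) - (‖g z‖ ^ 2 - 3 / 2 / μ * ‖g z‖ ^ 4 +
          μ / 2 * (2 * (‖g z‖ ^ 2 / μ) ^ 2 - ‖H z‖ ^ 2)) =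
          (‖g z‖ ^ 2 - μ * ‖H z‖) ^ 2 / (2 * μ) := by field_simp; ring
      have : 0 ≤ (‖g z‖ ^ 2 - μ * ‖H z‖) ^ 2 / (2 * μ) := by positivity
      linarith
    refine le_trans ?_ low
    have hHav : circleAverage (fun z => (H z ^ 2).re) 0 1 = ((H ^ 2) 0).re := avg_entire (hHd.pow 2)
    rw [circleAverage_fun_add i12 i3, circleAverage_fun_sub i1 i2, circleAverage_fun_smul,
      circleAverage_fun_smul, hHav, hg, parseval]
    simp only [hcn, smul_eq_mul]
    rw [← hS]
    have e7 : 0 ≤ ((H ^ 2) 0).re := by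
      rw [Pi.pow_apply, hH]
      simp only [h0]
      rw [← Complex.ofReal_mul, ← Complex.ofReal_pow, Complex.ofReal_re]
      positivity
    have e8 : 3 / 2 / μ * circleAverage (fun z => ‖poly N c z‖ ^ 4) 0 1 ≤ 3 / 2 / μ * (3 * S ^ 2) := by
      gcongr
    have e9 : 3 / 2 / μ * (3 * S ^ 2) = S / 2 := by rw [hμ]; field_simp; norm_num
    have e10 : 0 ≤ μ / 2 * ((H ^ 2) 0).re := by positivity
    linarith

/-- The unit disc. -/
abbrev Disc := Metric.ball (0:ℂ) 1

/-- Extension by zero of a function on the disc. -/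
def extD (f : BoundedContinuousFunction Disc ℂ) (z : ℂ) : ℂ :=
  open Classical in if h : z ∈ Disc then f ⟨z, h⟩ else 0

lemma extD_apply (f : BoundedContinuousFunction Disc ℂ) {z : ℂ} (h : z ∈ Disc) :
    extD f z = f ⟨z, h⟩ := by simp only [extD, dif_pos h]

lemma extD_norm_le (f : BoundedContinuousFunction Disc ℂ) (z : ℂ) : ‖extD f z‖ ≤ ‖f‖ := by
  by_cases h : z ∈ Disc
  · rw [extD_apply f h]; exact f.norm_coe_le_norm _
  · simp only [extD, dif_neg h, norm_zero]; exact norm_nonneg f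

lemma extD_add (f g : BoundedContinuousFunction Disc ℂ) : extD (f + g) = extD f + extD g := by
  ext z
  by_cases h : z ∈ Disc <;> simp [extD, h]

lemma extD_smul (c : ℂ) (f : BoundedContinuousFunction Disc ℂ) : extD (c • f) = c • extD f := by
  ext z
  by_cases h : z ∈ Disc <;> simp [extD, h]

lemma extD_sub (f g : BoundedContinuousFunction Disc ℂ) (z : ℂ) :
    extD (f - g) z = extD f z - extD g z := by
  by_cases h : z ∈ Disc <;> simp [extD, h]

/-- `H^∞` as a submodule of the bounded continuous functions on the disc. -/
def HInf : Submodule ℂ (BoundedContinuousFunction Disc ℂ) where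
  carrier := {f | DifferentiableOn ℂ (extD f) Disc}
  zero_mem' := by
    have : extD 0 = fun _ => (0:ℂ) := by ext z; simp [extD]
    simp only [Set.mem_setOf_eq, this]; exact differentiableOn_const _
  add_mem' := by
    intro f g hf hg
    simp only [Set.mem_setOf_eq, extD_add] at *
    exact hf.add hg
  smul_mem' := by
    intro c f hf
    simp only [Set.mem_setOf_eq, extD_smul] at *
    exact hf.const_smul c

lemma HInf_closed : IsClosed (HInf : Set (BoundedContinuousFunction Disc ℂ)) := by
  apply IsSeqClosed.isClosed
  intro u f hu hlim
  change DifferentiableOn ℂ (extD f) Disc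
  have ht : TendstoUniformlyOn (fun n => extD (u n)) (extD f) atTop Disc := by
    rw [Metric.tendstoUniformlyOn_iff]
    intro ε hε
    filter_upwards [Metric.tendsto_nhds.1 hlim ε hε] with n hn z _
    rw [dist_eq_norm, ← extD_sub]
    refine (extD_norm_le _ _).trans_lt ?_
    rwa [← dist_eq_norm, dist_comm]
  exact ht.tendstoLocallyUniformlyOn.differentiableOn (Eventually.of_forall hu) Metric.isOpen_ball

instance : CompleteSpace HInf := HInf_closed.completeSpace_coe

lemma taylor_add {f g : ℂ → ℂ} (hf : DifferentiableOn ℂ f Disc) (hg : DifferentiableOn ℂ g Disc)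
    (n : ℕ) : taylorCoeff (f + g) n = taylorCoeff f n + taylorCoeff g n := by
  have h0 : (0:ℂ) ∈ Disc := by simp
  have hf' : ContDiffAt ℂ n f 0 :=
    (hf.contDiffOn Metric.isOpen_ball).contDiffAt (Metric.isOpen_ball.mem_nhds h0)
  have hg' : ContDiffAt ℂ n g 0 :=
    (hg.contDiffOn Metric.isOpen_ball).contDiffAt (Metric.isOpen_ball.mem_nhds h0)
  simp only [taylorCoeff]
  rw [iteratedDeriv_add hf' hg', add_div]

lemma taylor_smul {f : ℂ → ℂ} (c : ℂ) (n : ℕ) :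
    taylorCoeff (c • f) n = c * taylorCoeff f n := by
  have : c • f = fun z => c * f z := rfl
  simp only [taylorCoeff]
  rw [this, iteratedDeriv_const_mul_field, mul_div_assoc]

lemma taylor_bound {f : ℂ → ℂ} (hf : DifferentiableOn ℂ f Disc) {B : ℝ}
    (hB : ∀ z, ‖f z‖ ≤ B) (n : ℕ) : ‖taylorCoeff f n‖ ≤ 2 ^ n * B := by
  have hcl : DiffContOnCl ℂ f (Metric.ball 0 (1/2)) := by
    apply (hf.mono ?_).diffContOnCl
    rw [closure_ball _ (by norm_num)]
    exact Metric.closedBall_subset_ball (by norm_num)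
  have := Complex.norm_iteratedDeriv_le_of_forall_mem_sphere_norm_le n (by norm_num) hcl
    (fun z _ => hB z)
  have hn : (0:ℝ) < n.factorial := by positivity
  rw [taylorCoeff, norm_div, Complex.norm_natCast, div_le_iff₀ hn]
  refine this.trans (le_of_eq ?_)
  rw [one_div, inv_pow, div_inv_eq_mul]; ring

/-- Coefficient functional on `H^∞`. -/
def coeffL (n : ℕ) : HInf →L[ℂ] ℂ :=
  LinearMap.mkContinuous
    { toFun := fun f => taylorCoeff (extD f.1) n
      map_add' := fun f g => by
        change taylorCoeff (extD (f.1 + g.1)) n = _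
        rw [extD_add, taylor_add f.2 g.2]
      map_smul' := fun c f => by
        change taylorCoeff (extD (c • f.1)) n = _
        rw [extD_smul, taylor_smul]; rfl } (2 ^ n)
    (fun f => taylor_bound f.2 (extD_norm_le f.1) n)

lemma coeffL_apply (n : ℕ) (f : HInf) : coeffL n f = taylorCoeff (extD f.1) n := rfl

lemma memHardy_top {f : ℂ → ℂ} (hf : DifferentiableOn ℂ f Disc) {B : ℝ}
    (hB : ∀ z ∈ Disc, ‖f z‖ ≤ B) : MemHardy ⊤ f := by
  refine ⟨(hf.analyticOnNhd Metric.isOpen_ball).analyticOn, B, ?_⟩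
  rintro _ ⟨r, ⟨hr0, hr1⟩, rfl⟩
  simp only [hardyMean, if_true, circleSup]
  apply ciSup_le
  intro t
  apply hB
  simp [Complex.norm_exp, abs_of_nonneg hr0, hr1]

/-- Truncation of a sequence. -/
def trunc (N : ℕ) (x : ℕ → ℂ) : ℕ → ℂ := fun n => if n < N then x n else 0

lemma trunc_eq (N : ℕ) (x : ℕ → ℂ) :
    trunc N x = ∑ n ∈ Finset.range N, x n • (Pi.single n 1 : ℕ → ℂ) := by
  ext k
  simp [trunc, Pi.single_apply]

lemma phi_trunc (φ : (ℕ → ℂ) →ₗ[ℂ] ℂ) (N : ℕ) (x : ℕ → ℂ) :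
    φ (trunc N x) = ∑ n ∈ Finset.range N, x n * φ (Pi.single n 1) := by
  rw [trunc_eq, map_sum]; simp

lemma hahn_banach (E : SeqLattice) (y : ℕ → ℂ) (hy : E.Mem y) :
    ∃ φ : (ℕ → ℂ) →ₗ[ℂ] ℂ, (∀ x, E.Mem x → ‖φ x‖ ≤ E.norm x) ∧ φ y = E.norm y := by
  let V : Submodule ℂ (ℕ → ℂ) :=
    { carrier := {x | E.Mem x}
      zero_mem' := E.zero_mem
      add_mem' := fun {a b} ha hb => E.add_mem a b ha hb
      smul_mem' := fun c x hx => E.smul_mem c x hx }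
  letI : Norm V := ⟨fun x => E.norm x.1⟩
  have core : NormedSpace.Core ℂ V :=
    { norm_nonneg := fun x => E.norm_nonneg x.1
      norm_smul := fun c x => E.norm_smul c x.1 x.2
      norm_triangle := fun x y => E.norm_add_le x.1 y.1 x.2 y.2
      norm_eq_zero_iff := fun x => (E.norm_eq_zero_iff x.1 x.2).trans (by
        rw [Subtype.ext_iff]; rfl) }
  letI : NormedAddCommGroup V := NormedAddCommGroup.ofCore core
  letI : NormedSpace ℂ V := NormedSpace.ofCore core
  obtain ⟨g, hg1, hgy⟩ := exists_dual_vector'' ℂ (⟨y, hy⟩ : V)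
  obtain ⟨φ, hφ⟩ := LinearMap.exists_extend (p := V) (g : V →ₗ[ℂ] ℂ)
  have hv : ∀ v : V, φ v.1 = g v := fun v => LinearMap.congr_fun hφ v
  refine ⟨φ, ?_, ?_⟩
  · intro x hx
    rw [show φ x = g ⟨x, hx⟩ from hv ⟨x, hx⟩]
    refine (g.le_opNorm _).trans ?_
    exact mul_le_of_le_one_left (E.norm_nonneg x) hg1
  · rw [show φ y = g ⟨y, hy⟩ from hv ⟨y, hy⟩, hgy]; rfl

lemma unif {X : AnalBanach} (hinf : EmbedHardyIn ⊤ X) {E : SeqLattice} {l : ℕ → ℂ}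
    (hl : l ∈ MultSet (coeffSpace X) {x | E.Mem x}) :
    ∃ C : ℝ, 0 ≤ C ∧ ∀ c : ℕ → ℂ, ∀ N,
      (∀ x, E.Mem x → ‖∑ n ∈ Finset.range N, c n * x n‖ ≤ E.norm x) →
      ∀ f : HInf, ‖∑ n ∈ Finset.range N, c n * (l n * coeffL n f)‖ ≤ C * ‖f‖ := by
  obtain ⟨C0, -, hX⟩ := hinf
  let ι := {p : (ℕ → ℂ) × ℕ //
    ∀ x, E.Mem x → ‖∑ n ∈ Finset.range p.2, p.1 n * x n‖ ≤ E.norm x}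
  let g : ι → HInf →L[ℂ] ℂ := fun p =>
    ∑ n ∈ Finset.range p.1.2, (p.1.1 n * l n) • coeffL n
  have hg : ∀ (p : ι) f, g p f = ∑ n ∈ Finset.range p.1.2, p.1.1 n * (l n * coeffL n f) := by
    intro p f
    simp only [g, ContinuousLinearMap.sum_apply, ContinuousLinearMap.smul_apply, smul_eq_mul,
      mul_assoc]
  obtain ⟨C, hC⟩ := banach_steinhaus (g := g) (fun f => by
    have hm := (hX (extD f.1) (memHardy_top f.2 (fun z _ => extD_norm_le f.1 z))).1
    refine ⟨E.norm (seqMul l (taylorCoeff (extD f.1))), fun p => ?_⟩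
    rw [hg]
    exact p.2 _ (hl _ ⟨_, hm, rfl⟩))
  refine ⟨max C 0, le_max_right _ _, fun c N hc f => ?_⟩
  have := (g ⟨(c, N), hc⟩).le_of_opNorm_le ((hC ⟨(c, N), hc⟩).trans (le_max_left C 0)) f
  rwa [hg] at this

lemma mem_trunc {X : AnalBanach} (hinf : EmbedHardyIn ⊤ X) {E : SeqLattice} {l : ℕ → ℂ}
    (hl : l ∈ MultSet (coeffSpace X) {x | E.Mem x}) (N : ℕ) (x : ℕ → ℂ) :
    E.Mem (trunc N (seqMul l x)) := by
  obtain ⟨C0, -, hX⟩ := hinf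
  have hs : ∀ n, E.Mem (seqMul l (Pi.single n 1)) := by
    intro n
    have hm := (hX (fun z => z ^ n) (memHardy_top (B := 1) (by fun_prop) (fun z hz => by
      rw [norm_pow]
      exact pow_le_one₀ (norm_nonneg _) (by simpa using (mem_ball_zero_iff.1 hz).le)))).1
    have e : taylorCoeff (fun z => z ^ n) = Pi.single n 1 := by
      ext k
      rw [taylorCoeff, iteratedDeriv_fun_pow_zero, Pi.single_apply]
      have := Nat.factorial_ne_zero n
      split_ifs with h
      · subst h; field_simp
      · simp
    have := hl _ ⟨_, hm, rfl⟩
    rwa [e] at this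
  induction N with
  | zero => convert E.zero_mem using 1; ext n; simp [trunc]
  | succ N ih =>
    have : trunc (N+1) (seqMul l x) = trunc N (seqMul l x) + x N • seqMul l (Pi.single N 1) := by
      ext k
      simp only [trunc, seqMul, Pi.add_apply, Pi.smul_apply, Pi.single_apply, smul_eq_mul]
      rcases lt_trichotomy k N with h | h | h
      · simp [h, h.ne, Nat.lt_succ_of_lt h]
      · subst h; simp [mul_comm]
      · rw [if_neg (by omega), if_neg (by omega), if_neg (by omega)]; simp
    rw [this]
    exact E.add_mem _ _ ih (E.smul_mem _ _ (hs N))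

lemma block {X : AnalBanach} (hinf : EmbedHardyIn ⊤ X) {E : SeqLattice} {l : ℕ → ℂ}
    (hl : l ∈ MultSet (coeffSpace X) {x | E.Mem x}) :
    ∃ K : ℝ, 0 ≤ K ∧ ∀ N x, E.norm (trunc N (seqMul l x)) ≤
      K * √(∑ n ∈ Finset.range N, ‖x n‖ ^ 2) := by
  obtain ⟨C, hC0, hC⟩ := unif hinf hl
  refine ⟨3 * C, by positivity, fun N x => ?_⟩
  obtain ⟨φ, hφ, hφy⟩ := hahn_banach E _ (mem_trunc hinf hl N x)
  set b : ℕ → ℂ := fun n => φ (Pi.single n 1) * l n with hb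
  have hS : √(∑ n ∈ Finset.range N, ‖b n‖ ^ 2) ≤ 3 * C := by
    obtain ⟨ε, hε, f, hfd, hfb, hlow⟩ := key N b
    set S := ∑ n ∈ Finset.range N, ‖b n‖ ^ 2 with hSdef
    have hS0 : 0 ≤ S := by positivity
    let F : BoundedContinuousFunction Disc ℂ :=
      BoundedContinuousFunction.ofNormedAddCommGroup (fun z : Disc => f z)
        (continuousOn_iff_continuous_restrict.1 hfd.continuousOn) (3 / 2 * √S)
        (fun z => hfb z.1 z.2)
    have hFf : ∀ z ∈ Disc, extD F z = f z := fun z hz => by rw [extD_apply F hz]; rfl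
    have hFn : ‖F‖ ≤ 3 / 2 * √S :=
      BoundedContinuousFunction.norm_ofNormedAddCommGroup_le _ (by positivity) _
    have hFm : F ∈ HInf := hfd.congr hFf
    have hco : ∀ n, coeffL n ⟨F, hFm⟩ = taylorCoeff f n := by
      intro n
      rw [coeffL_apply, taylorCoeff, taylorCoeff]
      congr 1
      apply Filter.EventuallyEq.iteratedDeriv_eq
      filter_upwards [Metric.isOpen_ball.mem_nhds (show (0:ℂ) ∈ Disc by simp)] with z hz
      exact hFf z hz
    have h1 := hC (fun n => ε n * φ (Pi.single n 1)) N (by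
      intro y hy
      have hen : ∀ n, ‖ε n‖ = 1 := fun n => by rcases hε n with h | h <;> simp [h]
      have hid := E.ideal y (trunc N (fun n => ε n * y n)) hy (by
        intro n
        simp only [trunc]
        split_ifs
        · simp [hen]
        · simp)
      have := (hφ _ hid.1).trans hid.2
      rw [phi_trunc] at this
      refine le_trans (le_of_eq ?_) this
      congr 1
      refine Finset.sum_congr rfl fun n _ => ?_
      ring) ⟨F, hFm⟩
    have h2 : S / 2 ≤ C * (3 / 2 * √S) := by
      refine hlow.trans ?_
      refine le_trans (le_of_eq ?_) (h1.trans (mul_le_mul_of_nonneg_left hFn hC0))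
      congr 1
      refine Finset.sum_congr rfl fun n _ => ?_
      rw [hco, hb]; ring
    have hs := Real.sq_sqrt hS0
    have hsn := Real.sqrt_nonneg S
    by_contra hcon
    push Not at hcon
    nlinarith
  have h3 : E.norm (trunc N (seqMul l x)) = ‖∑ n ∈ Finset.range N, b n * x n‖ := by
    have e : ∑ n ∈ Finset.range N, b n * x n = φ (trunc N (seqMul l x)) := by
      rw [phi_trunc]
      refine Finset.sum_congr rfl fun n _ => ?_
      rw [hb, seqMul]; ring
    rw [e, hφy, Complex.norm_real, Real.norm_of_nonneg (E.norm_nonneg _)]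
  rw [h3]
  calc _ ≤ ∑ n ∈ Finset.range N, ‖b n‖ * ‖x n‖ := by
        refine (norm_sum_le _ _).trans (le_of_eq ?_)
        simp
    _ ≤ √(∑ n ∈ Finset.range N, ‖b n‖ ^ 2) * √(∑ n ∈ Finset.range N, ‖x n‖ ^ 2) :=
        Real.sum_mul_le_sqrt_mul_sqrt _ _ _
    _ ≤ _ := by gcongr

lemma main_dir {X : AnalBanach} (hinf : EmbedHardyIn ⊤ X) {E : SeqLattice} {l : ℕ → ℂ}
    (hl : l ∈ MultSet (coeffSpace X) {x | E.Mem x}) {a : ℕ → ℂ} (ha : Memℓp a 2) :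
    E.Mem (seqMul l a) := by
  obtain ⟨K, hK0, hK⟩ := block hinf hl
  have hsum : Summable fun n => ‖a n‖ ^ 2 := by
    have := (memℓp_gen_iff (by norm_num)).1 ha
    simpa using this
  -- differences of truncations
  have hdiff : ∀ m n, m ≤ n → E.norm (trunc n (seqMul l a) - trunc m (seqMul l a)) ≤
      K * √(∑ k ∈ Finset.range n, ‖a k‖ ^ 2 - ∑ k ∈ Finset.range m, ‖a k‖ ^ 2) := by
    intro m n hmn
    have h := hK n (fun k => if k < m then 0 else a k)
    have e1 : trunc n (seqMul l (fun k => if k < m then 0 else a k)) =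
        trunc n (seqMul l a) - trunc m (seqMul l a) := by
      ext k
      simp only [trunc, seqMul, Pi.sub_apply]
      by_cases h1 : k < m
      · simp [h1, lt_of_lt_of_le h1 hmn]
      · simp [h1]
    have e2 : ∑ k ∈ Finset.range n, ‖(if k < m then 0 else a k : ℂ)‖ ^ 2 =
        ∑ k ∈ Finset.range n, ‖a k‖ ^ 2 - ∑ k ∈ Finset.range m, ‖a k‖ ^ 2 := by
      rw [← Finset.sum_range_add_sum_Ico _ hmn, ← Finset.sum_range_add_sum_Ico _ hmn,
        Finset.sum_eq_zero (s := Finset.range m), zero_add, add_sub_cancel_left]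
      · refine Finset.sum_congr rfl fun k hk => ?_
        rw [if_neg (by have := (Finset.mem_Ico.1 hk).1; omega)]
      · intro k hk
        simp [Finset.mem_range.1 hk]
    rwa [e1, e2] at h
  have hsymm : ∀ x y : ℕ → ℂ, E.Mem x → E.Mem y → E.norm (x - y) = E.norm (y - x) := by
    intro x y hx hy
    have hm : E.Mem (y - x) := by
      have := E.add_mem y ((-1:ℂ) • x) hy (E.smul_mem _ _ hx)
      convert this using 1
      simp [sub_eq_add_neg]
    have := E.norm_smul (-1) (y - x) hm
    simpa using this
  have hcau := (hsum.hasSum.tendsto_sum_nat).cauchySeq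
  obtain ⟨x, hx, hlim⟩ := E.complete (fun m => trunc m (seqMul l a))
    (fun m => mem_trunc hinf hl m a) (by
      intro ε hε
      have hδ : 0 < (ε / (K + 1)) ^ 2 := by positivity
      obtain ⟨N, hN⟩ := Metric.cauchySeq_iff.1 hcau _ hδ
      have main : ∀ m n, N ≤ m → m ≤ n →
          E.norm (trunc n (seqMul l a) - trunc m (seqMul l a)) ≤ ε := by
        intro m n hm hmn
        refine (hdiff m n hmn).trans ?_
        have h1 := hN n (hm.trans hmn) m hm
        rw [Real.dist_eq] at h1
        have h2 : √(∑ k ∈ Finset.range n, ‖a k‖ ^ 2 - ∑ k ∈ Finset.range m, ‖a k‖ ^ 2)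
            ≤ ε / (K + 1) := by
          rw [Real.sqrt_le_left (by positivity)]
          exact (le_abs_self _).trans h1.le
        calc _ ≤ K * (ε / (K + 1)) := by gcongr
          _ ≤ (K + 1) * (ε / (K + 1)) := by gcongr; linarith
          _ = ε := by field_simp
      refine ⟨N, fun m hm n hn => ?_⟩
      rcases le_total n m with h | h
      · exact main n m hn h
      · rw [hsymm _ _ (mem_trunc hinf hl m a) (mem_trunc hinf hl n a)]
        exact main m n hm h)
  have hxe : x = seqMul l a := by
    ext k
    by_contra hne
    set d : ℂ := seqMul l a k - x k with hd
    have hd0 : d ≠ 0 := sub_ne_zero.2 (Ne.symm hne)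
    have hle : ∀ m, k < m → E.Mem (Pi.single k d) ∧
        E.norm (Pi.single k d) ≤ E.norm (trunc m (seqMul l a) - x) := by
      intro m hm
      apply E.ideal
      · have := E.add_mem _ ((-1:ℂ) • x) (mem_trunc hinf hl m a) (E.smul_mem _ _ hx)
        convert this using 1
        simp [sub_eq_add_neg]
      · intro n
        by_cases hn : n = k
        · subst hn; simp [trunc, hm, hd]
        · simp [Pi.single_apply, hn]
    have h0 : E.norm (Pi.single k d) ≤ 0 := by
      refine ge_of_tendsto hlim ?_
      filter_upwards [eventually_gt_atTop k] with m hm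
      exact (hle m hm).2
    have h1 := (E.norm_eq_zero_iff _ (hle (k+1) (by omega)).1).1 (le_antisymm h0 (E.norm_nonneg _))
    have := congrFun h1 k
    simp at this
    exact hd0 this
  rwa [hxe] at hx

/-- If `H_∞ ↪ X ↪ H_2` then `M(X̂, E) = M(ℓ_2, E)` for every Banach sequence lattice `E`. -/
theorem stmt_3 (X : AnalBanach) (hinf : EmbedHardyIn ⊤ X) (h2 : EmbedInHardy X 2)
    (E : SeqLattice) :
    MultSet (coeffSpace X) {x | E.Mem x} = MultSet {x : ℕ → ℂ | Memℓp x 2} {x | E.Mem x} := by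
  apply Set.Subset.antisymm
  · intro l hl a ha
    exact main_dir hinf hl ha
  · rintro l hl _ ⟨f, hf, rfl⟩
    obtain ⟨C, -, hC⟩ := h2
    exact hl _ (memlp_of_hardy (hC f hf).1)
end
end

section
/- Let X be a Banach space of analytic functions with H_∞ ↪ X ↪ H_2 and let E be an order-continuous Banach sequence lattice with ℓ_2 ↪ E ↪ ℓ_∞. Then the multiplier operator M_λ : X → E is compact if and only if limsup_{n→∞} |λ_n| = 0. -/
open MeasureTheory Complex Filter Topology Set
open scoped ENNReal

noncomputable section

lemma aux_fourier {f : ℂ → ℂ} (hf : AnalyticOn ℂ f (Metric.ball (0:ℂ) 1)) {r : ℝ} (h0 : 0 < r)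
    (h1 : r < 1) (n : ℕ) :
    fourierCoeffOn Real.two_pi_pos (fun t : ℝ => f ((r : ℂ) * Complex.exp (t * Complex.I))) (n : ℤ)
      = taylorCoeff f n * (r : ℂ) ^ n := by
  have hd : DifferentiableOn ℂ f (Metric.closedBall 0 r) :=
    hf.differentiableOn.mono (Metric.closedBall_subset_ball h1)
  have hc := hd.circleIntegral_one_div_sub_center_pow_smul h0 n
  have hpi : (Real.pi : ℂ) ≠ 0 := by exact_mod_cast Real.pi_ne_zero
  have hr : (r : ℂ) ≠ 0 := by exact_mod_cast h0.ne'
  have hfac : (n.factorial : ℂ) ≠ 0 := by exact_mod_cast n.factorial_ne_zero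
  rw [fourierCoeffOn_eq_integral]
  have key : (∮ z in C(0, r), (1 / (z - 0) ^ (n + 1)) • f z) = (Complex.I / (r:ℂ) ^ n) *
      ∫ x in (0:ℝ)..(2 * Real.pi), fourier (-(n:ℤ)) (x : AddCircle (2 * Real.pi - 0)) •
        f ((r : ℂ) * Complex.exp (x * Complex.I)) := by
    rw [circleIntegral, ← intervalIntegral.integral_const_mul]
    congr 1
    ext t
    rw [fourier_coe_apply, deriv_circleMap]
    simp only [circleMap, smul_eq_mul, zero_add, sub_zero]
    have he : Complex.exp (2 * Real.pi * Complex.I * ((-(n:ℤ) : ℤ) : ℂ) * t / ((2 * Real.pi : ℝ) : ℂ))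
        = (Complex.exp (t * Complex.I) ^ n)⁻¹ := by
      rw [← Complex.exp_nat_mul, ← Complex.exp_neg]
      congr 1
      push_cast
      field_simp
    rw [he]
    have := Complex.exp_ne_zero (t * Complex.I)
    field_simp
    ring
  rw [key] at hc
  rw [taylorCoeff]
  generalize (∫ x in (0:ℝ)..(2 * Real.pi), fourier (-(n:ℤ)) (x : AddCircle (2 * Real.pi - 0)) •
        f ((r : ℂ) * Complex.exp (x * Complex.I))) = J at *
  have hI := Complex.I_ne_zero
  rw [smul_eq_mul] at hc
  rw [Complex.real_smul]
  push_cast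
  field_simp at hc ⊢
  linear_combination hc

lemma aux_bessel {f : ℂ → ℂ} (hf : MemHardy 2 f) (s : Finset ℕ) :
    ∑ n ∈ s, ‖taylorCoeff f n‖ ^ 2 ≤ hardyNorm 2 f ^ 2 := by
  have main : ∀ r ∈ Ioo (0:ℝ) 1, ∑ n ∈ s, (‖taylorCoeff f n‖ * r ^ n) ^ 2 ≤ hardyNorm 2 f ^ 2 := by
    rintro r ⟨h0, h1⟩
    have hcont : Continuous (fun t : ℝ => f ((r : ℂ) * Complex.exp (t * Complex.I))) := by
      refine hf.1.continuousOn.comp_continuous (by fun_prop) fun t => ?_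
      simp [Complex.norm_exp_ofReal_mul_I, abs_of_pos h0, h1]
    have hL : MemLp (fun t : ℝ => f ((r : ℂ) * Complex.exp (t * Complex.I))) 2
        (volume.restrict (Ioc 0 (2 * Real.pi))) := by
      refine MemLp.mono_measure (Measure.restrict_mono Ioc_subset_Icc_self le_rfl) ?_
      obtain ⟨K, hK⟩ := (isCompact_Icc (a := (0:ℝ)) (b := 2 * Real.pi)).exists_bound_of_continuousOn
        hcont.continuousOn
      refine MemLp.of_bound hcont.aestronglyMeasurable K ?_
      exact (ae_restrict_iff' measurableSet_Icc).2 (ae_of_all _ hK)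
    have hs := hasSum_sq_fourierCoeffOn Real.two_pi_pos hL
    have hle := sum_le_hasSum (s.map Nat.castEmbedding) (fun i _ => by positivity) hs
    rw [Finset.sum_map] at hle
    have hle2 : ∑ n ∈ s, (‖taylorCoeff f n‖ * r ^ n) ^ 2 ≤ (2 * Real.pi - 0)⁻¹ •
        ∫ x in (0:ℝ)..(2 * Real.pi), ‖f ((r : ℂ) * Complex.exp (x * Complex.I))‖ ^ 2 := by
      refine le_trans (le_of_eq (Finset.sum_congr rfl fun n _ => ?_)) hle
      rw [Nat.castEmbedding_apply, aux_fourier hf.1 h0 h1 n]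
      simp [abs_of_pos h0]
    refine hle2.trans ?_
    have hmean : hardyMean 2 f r ≤ hardyNorm 2 f :=
      le_csSup hf.2 ⟨r, ⟨h0.le, h1⟩, rfl⟩
    have hI : 0 ≤ (1 / (2 * Real.pi)) * ∫ x in (0:ℝ)..(2 * Real.pi),
        ‖f ((r : ℂ) * Complex.exp (x * Complex.I))‖ ^ 2 := by
      refine mul_nonneg (by positivity) (intervalIntegral.integral_nonneg Real.two_pi_pos.le ?_)
      intros; positivity
    have hm : hardyMean 2 f r = Real.sqrt ((1 / (2 * Real.pi)) * ∫ x in (0:ℝ)..(2 * Real.pi),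
        ‖f ((r : ℂ) * Complex.exp (x * Complex.I))‖ ^ 2) := by
      simp [hardyMean, circleMean, Real.sqrt_eq_rpow]
    have h3 : (2 * Real.pi - 0)⁻¹ •
        ∫ x in (0:ℝ)..(2 * Real.pi), ‖f ((r : ℂ) * Complex.exp (x * Complex.I))‖ ^ 2
        = hardyMean 2 f r ^ 2 := by
      rw [hm, Real.sq_sqrt hI]; simp
    rw [h3]
    have : 0 ≤ hardyMean 2 f r := by rw [hm]; positivity
    gcongr
  have ht : Tendsto (fun r : ℝ => ∑ n ∈ s, (‖taylorCoeff f n‖ * r ^ n) ^ 2) (𝓝[<] 1)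
      (𝓝 (∑ n ∈ s, (‖taylorCoeff f n‖ * 1 ^ n) ^ 2)) := by
    refine Tendsto.mono_left (Continuous.tendsto ?_ 1) nhdsWithin_le_nhds
    fun_prop
  simp only [one_pow, mul_one] at ht
  refine le_of_tendsto ht ?_
  filter_upwards [Ioo_mem_nhdsLT (zero_lt_one (α := ℝ))] with r hr using main r hr

lemma aux_l2 {x : ℕ → ℂ} {B : ℝ} (hB : 0 ≤ B) (h : ∀ s : Finset ℕ, ∑ n ∈ s, ‖x n‖ ^ 2 ≤ B ^ 2) :
    Memℓp x 2 ∧ lqNorm 2 x ≤ B := by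
  have hs : Summable fun n => ‖x n‖ ^ 2 := summable_of_sum_le (fun _ => by positivity) h
  constructor
  · rw [memℓp_gen_iff (by simp)]
    simpa using hs
  · have : lqNorm 2 x = Real.sqrt (∑' n, ‖x n‖ ^ 2) := by
      simp [lqNorm, Real.sqrt_eq_rpow]
    rw [this]
    exact Real.sqrt_le_iff.2 ⟨hB, hs.tsum_le_of_sum_le h⟩

lemma aux_coeff_pow (n k : ℕ) (c : ℂ) :
    taylorCoeff (c • fun z : ℂ => z ^ n) k = if k = n then c else 0 := by
  rw [taylorCoeff, iteratedDeriv_const_smul_field]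
  have : iteratedDeriv k (fun z : ℂ => z ^ n) 0 = if k = n then (n.factorial : ℂ) else 0 := by
    rw [iteratedDeriv_fun_pow_zero]
    simp
  rw [this]
  have : (n.factorial : ℂ) ≠ 0 := by exact_mod_cast n.factorial_ne_zero
  split_ifs with h
  · subst h; simp [this]
  · simp

lemma aux_hinf (n : ℕ) : MemHardy ⊤ (fun z : ℂ => z ^ n) ∧ hardyNorm ⊤ (fun z : ℂ => z ^ n) ≤ 1 := by
  have h : ∀ y ∈ (fun r => hardyMean ⊤ (fun z : ℂ => z ^ n) r) '' Set.Ico (0:ℝ) 1, y ≤ 1 := by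
    rintro _ ⟨r, ⟨h0, h1⟩, rfl⟩
    simp only [hardyMean, if_true, circleSup]
    refine ciSup_le fun t => ?_
    simp only [norm_pow, norm_mul, Complex.norm_exp_ofReal_mul_I, Complex.norm_real, mul_one,
      Real.norm_eq_abs, abs_of_nonneg h0]
    exact pow_le_one₀ h0 h1.le
  refine ⟨⟨?_, 1, h⟩, csSup_le (Set.Nonempty.image _ ⟨0, by simp⟩) h⟩
  exact (analyticOnNhd_id.pow n).analyticOn

lemma aux_nec (X : AnalBanach) (hinf : EmbedHardyIn ⊤ X) 
    (E : SeqLattice) 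
    (hEinf : ∃ C : ℝ, 0 < C ∧ ∀ x, E.Mem x → ∀ n, ‖x n‖ ≤ C * E.norm x)
    (l : ℕ → ℂ) (h : MulCompactX X E l) : Tendsto (fun n => l n) atTop (𝓝 0) := by
  classical
  obtain ⟨C, hC, hX⟩ := hinf
  obtain ⟨D, hD, hE⟩ := hEinf
  obtain ⟨hmem, hcomp⟩ := h
  have hsub : ∀ x y, E.Mem x → E.Mem y → E.Mem (x - y) := by
    intro x y hx hy
    have := E.add_mem _ _ hx (E.smul_mem (-1) y hy)
    simpa [sub_eq_add_neg] using this
  rw [Metric.tendsto_atTop]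
  intro ε hε
  obtain ⟨Z, hZ, hA⟩ := hcomp (ε / (4 * C * D)) (by positivity)
  have hz : ∀ n, ∃ z ∈ Z, ∀ k, ‖(if k = n then l k * (C⁻¹ : ℂ) else 0) - z k‖ ≤ ε / (4 * C) := by
    intro n
    obtain ⟨hm, hn⟩ := hX _ (aux_hinf n).1
    have hn1 : X.norm (fun z : ℂ => z ^ n) ≤ C :=
      hn.trans (by nlinarith [(aux_hinf n).2])
    have hfm := X.smul_mem (C⁻¹ : ℂ) _ hm
    have hfn : X.norm ((C⁻¹ : ℂ) • fun z : ℂ => z ^ n) ≤ 1 := by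
      rw [X.norm_smul _ _ hm, norm_inv, Complex.norm_real, Real.norm_eq_abs, abs_of_pos hC,
        inv_mul_le_iff₀ hC]
      linarith
    obtain ⟨z, hzZ, hzn⟩ := hA _ ⟨_, ⟨hfm, hfn⟩, rfl⟩
    refine ⟨z, hzZ, fun k => ?_⟩
    have h1 := hE _ (hsub _ _ (hmem _ hfm) (hZ z hzZ)) k
    have h2 : D * (ε / (4 * C * D)) = ε / (4 * C) := by field_simp
    have h3 := h1.trans ((mul_le_mul_of_nonneg_left hzn hD.le).trans h2.le)
    simpa [seqMul, aux_coeff_pow] using h3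
  choose φ hφZ hφ using hz
  have hinj : Set.InjOn φ {n | ε ≤ ‖l n‖} := by
    intro n hn m hm hnm
    by_contra hne
    have h1 := hφ n n
    have h2 := hφ m n
    rw [← hnm] at h2
    simp only [if_true, if_neg hne, zero_sub, norm_neg] at h1 h2
    have h3 : ‖l n * (C⁻¹ : ℂ)‖ ≤ ε / (4 * C) + ε / (4 * C) := by
      have := norm_add_le (l n * (C⁻¹ : ℂ) - φ n n) (φ n n)
      rw [sub_add_cancel] at this
      linarith
    rw [norm_mul, norm_inv, Complex.norm_real, Real.norm_eq_abs, abs_of_pos hC,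
      ← div_eq_mul_inv, div_le_iff₀ hC] at h3
    have h4 : (ε / (4 * C) + ε / (4 * C)) * C = ε / 2 := by field_simp; norm_num
    have hn' : ε ≤ ‖l n‖ := hn
    linarith
  have hfin : {n | ε ≤ ‖l n‖}.Finite :=
    Set.Finite.of_injOn (fun n _ => (hφZ n : φ n ∈ (Z : Set (ℕ → ℂ)))) hinj Z.finite_toSet
  obtain ⟨N, hN⟩ := hfin.bddAbove
  refine ⟨N + 1, fun n hn => ?_⟩
  by_contra hcon
  rw [dist_zero_right, not_lt] at hcon
  have := hN hcon
  omega

lemma aux_suf (X : AnalBanach) (h2 : EmbedInHardy X 2)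
    (E : SeqLattice)
    (h2E : ∃ C : ℝ, 0 < C ∧ ∀ x : ℕ → ℂ, Memℓp x 2 → E.Mem x ∧ E.norm x ≤ C * lqNorm 2 x)
    (l : ℕ → ℂ) (hl : Tendsto (fun n => l n) atTop (𝓝 0)) : MulCompactX X E l := by
  classical
  obtain ⟨C, hC, hX⟩ := h2
  obtain ⟨D, hD, hE⟩ := h2E
  obtain ⟨L, hL⟩ : ∃ L, ∀ n, ‖l n‖ ≤ L := by
    obtain ⟨L, hL⟩ := hl.norm.bddAbove_range
    exact ⟨L, fun n => hL ⟨n, rfl⟩⟩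
  have hL0 : 0 ≤ L := (norm_nonneg _).trans (hL 0)
  have hE' : ∀ (x : ℕ → ℂ) (B : ℝ), 0 ≤ B → (∀ s : Finset ℕ, ∑ n ∈ s, ‖x n‖ ^ 2 ≤ B ^ 2) →
      E.Mem x ∧ E.norm x ≤ D * B := by
    intro x B hB h
    obtain ⟨h1, h2⟩ := aux_l2 hB h
    exact ⟨(hE x h1).1, (hE x h1).2.trans (by gcongr)⟩
  refine ⟨fun f hf => ?_, fun ε hε => ?_⟩
  · refine (hE' _ (L * |hardyNorm 2 f|) (by positivity) fun s => ?_).1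
    rw [mul_pow, sq_abs]
    calc ∑ n ∈ s, ‖seqMul l (taylorCoeff f) n‖ ^ 2
        ≤ ∑ n ∈ s, L ^ 2 * ‖taylorCoeff f n‖ ^ 2 := by
          refine Finset.sum_le_sum fun n _ => ?_
          rw [seqMul, norm_mul, mul_pow]
          gcongr
          exact hL n
      _ = L ^ 2 * ∑ n ∈ s, ‖taylorCoeff f n‖ ^ 2 := by rw [Finset.mul_sum]
      _ ≤ _ := by gcongr; exact aux_bessel (hX f hf).1 s
  · -- coefficients of the ball are bounded by `C` in `ℓ_2`
    have hco : ∀ f, X.Mem f → X.norm f ≤ 1 → ∀ s : Finset ℕ,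
        ∑ n ∈ s, ‖taylorCoeff f n‖ ^ 2 ≤ C ^ 2 := by
      intro f hf hn s
      have h1 := aux_bessel (hX f hf).1 s
      obtain ⟨h3, h4⟩ := hX f hf
      have h0 : 0 ≤ hardyNorm 2 f := by
        refine Real.sSup_nonneg ?_
        rintro _ ⟨r, _, rfl⟩
        simp only [hardyMean, circleMean]
        rw [if_neg (by simp)]
        refine Real.rpow_nonneg (mul_nonneg (by positivity)
          (intervalIntegral.integral_nonneg Real.two_pi_pos.le ?_)) _
        intros; positivity
      refine h1.trans ?_
      have : hardyNorm 2 f ≤ C := h4.trans (by nlinarith)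
      gcongr
    set δ := ε / (2 * D) with hδ
    have hδ0 : 0 < δ := by positivity
    obtain ⟨N, hN⟩ := Metric.tendsto_atTop.1 hl (δ / C) (by positivity)
    set η := δ / (N + 1) with hη
    have hη0 : 0 < η := by positivity
    have htb : TotallyBounded (Metric.closedBall (0 : Fin N → ℂ) (L * C)) :=
      (isCompact_closedBall _ _).totallyBounded
    obtain ⟨T, hT, hcov⟩ := Metric.totallyBounded_iff.1 htb η hη0
    let ext : (Fin N → ℂ) → ℕ → ℂ := fun v n => if h : n < N then v ⟨n, h⟩ else 0
    have hsumN : ∀ (x : ℕ → ℂ) (b : ℝ), (∀ n < N, ‖x n‖ ^ 2 ≤ b ^ 2) → ∀ s : Finset ℕ,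
        ∑ n ∈ s.filter (· < N), ‖x n‖ ^ 2 ≤ N * b ^ 2 := by
      intro x b hb s
      calc _ ≤ ∑ n ∈ Finset.range N, ‖x n‖ ^ 2 := by
              refine Finset.sum_le_sum_of_subset_of_nonneg ?_ fun _ _ _ => by positivity
              intro n hn; simp at hn ⊢; exact hn.2
        _ ≤ ∑ n ∈ Finset.range N, b ^ 2 :=
              Finset.sum_le_sum fun n hn => hb n (Finset.mem_range.1 hn)
        _ = N * b ^ 2 := by simp
    refine ⟨hT.toFinset.image ext, ?_, ?_⟩
    · intro z hz
      obtain ⟨v, hv, rfl⟩ := Finset.mem_image.1 hz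
      refine (hE' _ (N * ‖v‖) (by positivity) fun s => ?_).1
      rw [← Finset.sum_filter_add_sum_filter_not s (· < N)]
      have h1 := hsumN (ext v) ‖v‖ (fun n hn => by
        simp only [ext, dif_pos hn]; gcongr; exact norm_le_pi_norm v _) s
      have h2 : ∑ n ∈ s with ¬ n < N, ‖ext v n‖ ^ 2 = 0 := by
        refine Finset.sum_eq_zero fun n hn => ?_
        simp [ext, (Finset.mem_filter.1 hn).2]
      rw [h2, add_zero]
      refine h1.trans ?_
      rw [mul_pow]
      gcongr
      exact_mod_cast Nat.le_self_pow (by norm_num) N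
    · rintro _ ⟨f, ⟨hf, hfn⟩, rfl⟩
      have hc := hco f hf hfn
      have hc1 : ∀ n, ‖taylorCoeff f n‖ ≤ C := fun n => by
        have := hc {n}
        rw [Finset.sum_singleton] at this
        exact le_of_sq_le_sq this hC.le
      have hv : (fun i : Fin N => l i * taylorCoeff f i) ∈
          Metric.closedBall (0 : Fin N → ℂ) (L * C) := by
        rw [mem_closedBall_zero_iff, pi_norm_le_iff_of_nonneg (by positivity)]
        intro i
        rw [norm_mul]
        exact mul_le_mul (hL _) (hc1 _) (norm_nonneg _) hL0
      obtain ⟨v, hvT, hvd⟩ := Set.mem_iUnion₂.1 (hcov hv)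
      refine ⟨ext v, Finset.mem_image_of_mem _ (hT.mem_toFinset.2 hvT), ?_⟩
      have hgoal : D * (2 * δ) = ε := by rw [hδ]; field_simp
      rw [← hgoal]
      refine (hE' _ (2 * δ) (by positivity) fun s => ?_).2
      rw [← Finset.sum_filter_add_sum_filter_not s (· < N)]
      have h1 := hsumN (seqMul l (taylorCoeff f) - ext v) η (fun n hn => by
        have := (dist_le_pi_dist (fun i : Fin N => l i * taylorCoeff f i) v ⟨n, hn⟩).trans
          (Metric.mem_ball.1 hvd).le
        simp only [ext, dif_pos hn, Pi.sub_apply, seqMul]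
        rw [dist_eq_norm] at this
        gcongr) s
      have h2 : ∑ n ∈ s with ¬ n < N, ‖(seqMul l (taylorCoeff f) - ext v) n‖ ^ 2 ≤ δ ^ 2 := by
        calc _ ≤ ∑ n ∈ s with ¬ n < N, (δ / C) ^ 2 * ‖taylorCoeff f n‖ ^ 2 := by
                refine Finset.sum_le_sum fun n hn => ?_
                have hn' := (Finset.mem_filter.1 hn).2
                simp only [ext, dif_neg hn', Pi.sub_apply, seqMul, sub_zero, norm_mul, mul_pow]
                gcongr
                have := hN n (not_lt.1 hn')
                rw [dist_zero_right] at this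
                exact this.le
          _ = (δ / C) ^ 2 * ∑ n ∈ s with ¬ n < N, ‖taylorCoeff f n‖ ^ 2 := by rw [Finset.mul_sum]
          _ ≤ (δ / C) ^ 2 * C ^ 2 := by gcongr; exact hc _
          _ = δ ^ 2 := by field_simp
      have h3 : N * η ^ 2 ≤ δ ^ 2 := by
        have : (N + 1 : ℝ) * η = δ := by rw [hη]; field_simp
        rw [← this]
        have hN0 : (0:ℝ) ≤ N := by positivity
        nlinarith [sq_nonneg η, mul_nonneg hN0 (sq_nonneg η), mul_nonneg (mul_nonneg hN0 hN0) (sq_nonneg η)]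
      nlinarith [sq_nonneg δ]

/-- If `H_∞ ↪ X ↪ H_2` and `E` is order-continuous with `ℓ_2 ↪ E ↪ ℓ_∞`, then
`M_λ : X → E` is compact iff `λ_n → 0`. -/
theorem stmt_15 (X : AnalBanach) (hinf : EmbedHardyIn ⊤ X) (h2 : EmbedInHardy X 2)
    (E : SeqLattice) (hE : OrderContinuous E)
    (h2E : ∃ C : ℝ, 0 < C ∧ ∀ x : ℕ → ℂ, Memℓp x 2 → E.Mem x ∧ E.norm x ≤ C * lqNorm 2 x)
    (hEinf : ∃ C : ℝ, 0 < C ∧ ∀ x, E.Mem x → ∀ n, ‖x n‖ ≤ C * E.norm x)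
    (l : ℕ → ℂ) :
    MulCompactX X E l ↔ Tendsto (fun n => l n) atTop (𝓝 0) := by
  exact ⟨aux_nec X hinf E hEinf l, aux_suf X h2 E h2E l⟩
end
end
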